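/- For all fixed reals a⁻, a⁺ ≥ 0 there is a constant C > 0 such that for all integers N⁻, N⁺ ≥ 0 with N⁻ + N⁺ ≥ 1, the spectral gap λ of the Metropolis chain for the measure π on {−N⁻,…,N⁺} satisfies λ ≤ C · min{ 1/(N⁻+N⁺)², max{ (1+N⁻)^{−(1+a⁻)}, (1+N⁺)^{−(1+a⁺)} } }. -/

import Mathlib

open Finset

/-- The unnormalized density `F(x) = (1+|x|)^{a⁻}` for `x ≤ 0` and
`(1+|x|)^{a⁺}` for `x > 0` on `ℤ`. -/
noncomputable def metroF (am ap : ℝ) (x : ℤ) : ℝ :=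
  if x ≤ 0 then ((1 + |x| : ℤ) : ℝ) ^ am else ((1 + |x| : ℤ) : ℝ) ^ ap

/-- The probability measure on `{-N⁻,…,N⁺}` proportional to `metroF`. -/
noncomputable def metroPi (am ap : ℝ) (Nm Np : ℤ) (x : ℤ) : ℝ :=
  metroF am ap x / ∑ y ∈ Finset.Icc (-Nm) Np, metroF am ap y

/-- Dirichlet form of the Metropolis chain for `metroPi` based on
nearest-neighbor random walk on `{-N⁻,…,N⁺}`. -/
noncomputable def metroDirichlet (am ap : ℝ) (Nm Np : ℤ) (u : ℤ → ℝ) : ℝ :=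
  ∑ x ∈ Finset.Icc (-Nm) (Np - 1),
    (u (x + 1) - u x) ^ 2 *
      (1 / 2 * min (metroPi am ap Nm Np x) (metroPi am ap Nm Np (x + 1)))

/-- Variance with respect to `metroPi`. -/
noncomputable def metroVar (am ap : ℝ) (Nm Np : ℤ) (u : ℤ → ℝ) : ℝ :=
  ∑ x ∈ Finset.Icc (-Nm) Np,
    (u x - ∑ y ∈ Finset.Icc (-Nm) Np, u y * metroPi am ap Nm Np y) ^ 2 *
      metroPi am ap Nm Np x

/-- Spectral gap of the Metropolis chain:
`λ = inf { ℰ(u,u)/Var_π(u) : Var_π(u) ≠ 0 }`. -/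
noncomputable def metroGap (am ap : ℝ) (Nm Np : ℤ) : ℝ :=
  sInf {r : ℝ | ∃ u : ℤ → ℝ, metroVar am ap Nm Np u ≠ 0 ∧
    r = metroDirichlet am ap Nm Np u / metroVar am ap Nm Np u}

theorem metroF_natCast (am ap : ℝ) (k : ℕ) : metroF am ap (k : ℤ) = (1 + (k : ℝ)) ^ ap := by
  rcases Nat.eq_zero_or_pos k with rfl | hk
  · simp [metroF]
  · have : ¬ ((k : ℤ) ≤ 0) := by omega
    simp only [metroF, if_neg this, Nat.abs_cast]
    push_cast
    rfl

theorem metroF_neg_natCast (am ap : ℝ) (k : ℕ) :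
    metroF am ap (-(k : ℤ)) = (1 + (k : ℝ)) ^ am := by
  have : -(k : ℤ) ≤ 0 := by omega
  simp only [metroF, if_pos this, abs_neg, Nat.abs_cast]
  push_cast
  rfl

theorem metroF_pos (am ap : ℝ) (x : ℤ) : 0 < metroF am ap x := by
  obtain ⟨k, rfl | rfl⟩ := Int.eq_nat_or_neg x
  · rw [metroF_natCast]; positivity
  · rw [metroF_neg_natCast]; positivity

/-- A test function bounds the spectral gap; the normalization and the mean drop out. -/
theorem metroGap_le {am ap : ℝ} {Nm Np : ℤ} (u : ℤ → ℝ) {E V : ℝ} (hV : 0 < V)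
    (hvar : ∀ c : ℝ, V ≤ ∑ x ∈ Icc (-Nm) Np, (u x - c) ^ 2 * metroF am ap x)
    (hE : ∑ x ∈ Icc (-Nm) (Np - 1),
      (u (x + 1) - u x) ^ 2 * (1 / 2 * min (metroF am ap x) (metroF am ap (x + 1))) ≤ E) :
    metroGap am ap Nm Np ≤ E / V := by
  have hne : (Icc (-Nm) Np).Nonempty := by
    by_contra h
    have := hvar 0
    rw [not_nonempty_iff_eq_empty.1 h, sum_empty] at this
    linarith
  have hZ : 0 < ∑ y ∈ Icc (-Nm) Np, metroF am ap y := sum_pos (fun x _ => metroF_pos am ap x) hne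
  have hvar' : V / (∑ y ∈ Icc (-Nm) Np, metroF am ap y) ≤ metroVar am ap Nm Np u := by
    simp only [metroVar]
    generalize (∑ y ∈ Icc (-Nm) Np, u y * metroPi am ap Nm Np y) = c
    simp only [metroPi, mul_div_assoc', ← sum_div]
    gcongr
    exact hvar c
  have hdir : metroDirichlet am ap Nm Np u ≤ E / (∑ y ∈ Icc (-Nm) Np, metroF am ap y) := by
    simp only [metroDirichlet, metroPi, min_div_div_right hZ.le, mul_div_assoc', ← sum_div]
    gcongr
  have hdir0 : ∀ v, 0 ≤ metroDirichlet am ap Nm Np v := fun v => by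
    have hpi : ∀ x, 0 ≤ metroPi am ap Nm Np x := fun x => div_nonneg (metroF_pos am ap x).le hZ.le
    exact sum_nonneg fun x _ => mul_nonneg (sq_nonneg _)
      (mul_nonneg (by norm_num) (le_min (hpi _) (hpi _)))
  have hvar0 : ∀ v, 0 ≤ metroVar am ap Nm Np v := fun v =>
    sum_nonneg fun x _ => mul_nonneg (sq_nonneg _) (div_nonneg (metroF_pos am ap x).le hZ.le)
  have hVZ : 0 < V / (∑ y ∈ Icc (-Nm) Np, metroF am ap y) := div_pos hV hZ
  calc metroGap am ap Nm Np
      ≤ metroDirichlet am ap Nm Np u / metroVar am ap Nm Np u := by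
        refine csInf_le ⟨0, ?_⟩ ⟨u, (hVZ.trans_le hvar').ne', rfl⟩
        rintro r ⟨v, -, rfl⟩
        exact div_nonneg (hdir0 v) (hvar0 v)
    _ ≤ (E / (∑ y ∈ Icc (-Nm) Np, metroF am ap y)) /
          (V / (∑ y ∈ Icc (-Nm) Np, metroF am ap y)) := by
        gcongr
        exact (hdir0 u).trans hdir
    _ = E / V := div_div_div_cancel_right₀ hZ.ne' E V

theorem sum_range_comp_le_sum {f : ℕ → ℤ} (hf : Function.Injective f) {n : ℕ} {s : Finset ℤ}
    (hs : ∀ k < n, f k ∈ s) {g : ℤ → ℝ} (hg : ∀ x, 0 ≤ g x) :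
    ∑ k ∈ range n, g (f k) ≤ ∑ x ∈ s, g x := by
  rw [← sum_image (f := g) (g := f) fun a _ b _ h => hf h]
  refine sum_le_sum_of_subset_of_nonneg ?_ fun x _ _ => hg x
  intro x hx
  obtain ⟨k, hk, rfl⟩ := mem_image.1 hx
  exact hs k (mem_range.1 hk)

theorem le_sum_range_sub_sq (n : ℕ) (c : ℝ) :
    (n : ℝ) * ((n : ℝ) ^ 2 - 1) / 12 ≤ ∑ k ∈ range n, ((k : ℝ) - c) ^ 2 := by
  have h : ∑ k ∈ range n, ((k : ℝ) - c) ^ 2 =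
      n * (c - ((n : ℝ) - 1) / 2) ^ 2 + (n : ℝ) * ((n : ℝ) ^ 2 - 1) / 12 := by
    induction n with
    | zero => simp
    | succ n ih => rw [sum_range_succ, ih]; push_cast; ring
  rw [h]
  have : 0 ≤ (n : ℝ) * (c - ((n : ℝ) - 1) / 2) ^ 2 := by positivity
  linarith

/-- If the weight is `(1 + k) ^ a` along `f`, a function increasing linearly along `f` has large
variance. -/
theorem le_sum_sub_sq_mul {a : ℝ} (ha : 0 ≤ a) {N : ℕ} {f : ℕ → ℤ}
    (hf : Function.Injective f) {s : Finset ℤ} (hs : ∀ k ≤ N, f k ∈ s) {F u : ℤ → ℝ}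
    (hF : ∀ x, 0 ≤ F x) (hFf : ∀ k, F (f k) = (1 + (k : ℝ)) ^ a) (hu : ∀ k, u (f k) = k) (c : ℝ) :
    (N : ℝ) ^ 3 / 96 * ((1 + (N : ℝ)) / 2) ^ a ≤ ∑ x ∈ s, (u x - c) ^ 2 * F x := by
  set h := N / 2 with hh
  set n := N - N / 2 + 1 with hn
  have hh' : (N : ℝ) ≤ 2 * h + 1 := by exact_mod_cast (by omega : N ≤ 2 * h + 1)
  have hn' : (N : ℝ) + 2 ≤ 2 * n := by exact_mod_cast (by omega : N + 2 ≤ 2 * n)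
  have hN : (0 : ℝ) ≤ N := N.cast_nonneg
  calc (N : ℝ) ^ 3 / 96 * ((1 + (N : ℝ)) / 2) ^ a
      ≤ ((n : ℝ) * ((n : ℝ) ^ 2 - 1) / 12) * ((1 + (N : ℝ)) / 2) ^ a := by
        refine mul_le_mul_of_nonneg_right ?_ (by positivity)
        have h1 : (N : ℝ) ^ 2 / 4 ≤ (n : ℝ) ^ 2 - 1 := by nlinarith
        have h2 : (N : ℝ) / 2 * ((N : ℝ) ^ 2 / 4) ≤ n * ((n : ℝ) ^ 2 - 1) := by
          gcongr
          linarith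
        linarith
    _ ≤ (∑ k ∈ range n, ((k : ℝ) - (c - h)) ^ 2) * ((1 + (N : ℝ)) / 2) ^ a := by
        gcongr
        exact le_sum_range_sub_sq n _
    _ ≤ ∑ k ∈ range n, (u (f (h + k)) - c) ^ 2 * F (f (h + k)) := by
        rw [sum_mul]
        refine sum_le_sum fun k _ => ?_
        rw [hu, hFf]
        push_cast
        rw [show (k : ℝ) - (c - h) = h + k - c by ring]
        gcongr
        have : (0 : ℝ) ≤ k := k.cast_nonneg
        linarith
    _ ≤ ∑ x ∈ s, (u x - c) ^ 2 * F x :=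
        sum_range_comp_le_sum (f := fun k => f (h + k)) (g := fun x => (u x - c) ^ 2 * F x)
          (fun i j hij => Nat.add_left_cancel (hf hij))
          (fun k hk => hs _ (by omega)) (fun x => mul_nonneg (sq_nonneg _) (hF x))

/-- If the weight is `(1 + k) ^ a` along `f`, the points `f k` with `N / 2 ≤ k ≤ N` have large
mass. -/
theorem le_sum_of_rpow {a : ℝ} (ha : 0 ≤ a) {N : ℕ} {f : ℕ → ℤ} (hf : Function.Injective f)
    {s : Finset ℤ} (hs : ∀ k ≤ N, N ≤ 2 * k → f k ∈ s) {F : ℤ → ℝ}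
    (hF : ∀ x, 0 ≤ F x) (hFf : ∀ k, F (f k) = (1 + (k : ℝ)) ^ a) :
    ((1 + (N : ℝ)) / 2) ^ (1 + a) ≤ ∑ x ∈ s, F x := by
  set h := (N + 1) / 2 with hh
  set n := N - (N + 1) / 2 + 1 with hn
  have hh' : (N : ℝ) ≤ 2 * h := by exact_mod_cast (by omega : N ≤ 2 * h)
  have hn' : (N : ℝ) + 1 ≤ 2 * n := by exact_mod_cast (by omega : N + 1 ≤ 2 * n)
  calc ((1 + (N : ℝ)) / 2) ^ (1 + a)
      = (1 + (N : ℝ)) / 2 * ((1 + (N : ℝ)) / 2) ^ a := by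
        rw [Real.rpow_add (by positivity), Real.rpow_one]
    _ ≤ n * ((1 + (N : ℝ)) / 2) ^ a := by
        gcongr
        linarith
    _ = ∑ k ∈ range n, ((1 + (N : ℝ)) / 2) ^ a := by simp
    _ ≤ ∑ k ∈ range n, F (f (h + k)) := by
        refine sum_le_sum fun k _ => ?_
        rw [hFf]
        push_cast
        gcongr
        have : (0 : ℝ) ≤ k := k.cast_nonneg
        linarith
    _ ≤ ∑ x ∈ s, F x :=
        sum_range_comp_le_sum (f := fun k => f (h + k)) (fun i j hij => Nat.add_left_cancel (hf hij))
          (fun k hk => hs _ (by omega) (by omega)) hF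

theorem energy_div_variance_eq {a N : ℝ} (hN : 0 < N) :
    N * (1 + N) ^ a / (N ^ 3 / 96 * ((1 + N) / 2) ^ a) = 96 * 2 ^ a / N ^ 2 := by
  have : 0 < (1 + N) ^ a := by positivity
  have : 0 < (2 : ℝ) ^ a := by positivity
  rw [Real.div_rpow (by positivity) (by positivity)]
  field_simp

theorem metroGap_le_right {am ap : ℝ} (hap : 0 ≤ ap) (Nm Np : ℕ) (hN : 1 ≤ Np) :
    metroGap am ap Nm Np ≤ 96 * 2 ^ ap / (Np : ℝ) ^ 2 := by
  have hN' : (0 : ℝ) < Np := by exact_mod_cast hN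
  rw [← energy_div_variance_eq hN']
  refine metroGap_le (fun x => ((max x 0 : ℤ) : ℝ)) (by positivity) (fun c => ?_) ?_
  · refine le_sum_sub_sq_mul hap (f := fun k => (k : ℤ)) Nat.cast_injective (fun k hk => ?_)
      (fun x => (metroF_pos am ap x).le) (metroF_natCast am ap) (fun k => ?_) c
    · simp only [mem_Icc]; omega
    · simp
  · calc _ ≤ ∑ x ∈ Icc (-(Nm : ℤ)) (Np - 1),
            if x ∈ Icc (0 : ℤ) (Np - 1) then (1 + (Np : ℝ)) ^ ap else 0 := by
          refine sum_le_sum fun x hx => ?_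
          simp only [mem_Icc] at hx ⊢
          split_ifs with h
          · obtain ⟨k, rfl⟩ := Int.eq_ofNat_of_zero_le h.1
            have hk : (k : ℝ) + 1 ≤ Np := by exact_mod_cast (by omega : k + 1 ≤ Np)
            have h1 : max ((k : ℤ) + 1) 0 = k + 1 := by omega
            have h2 : max (k : ℤ) 0 = k := by omega
            have h3 : metroF am ap k ≤ (1 + (Np : ℝ)) ^ ap := by
              rw [metroF_natCast]
              gcongr
              linarith
            have h4 : 0 < metroF am ap k := metroF_pos am ap k
            rw [h1, h2]
            push_cast
            have := min_le_left (metroF am ap k) (metroF am ap (k + 1))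
            linarith
          · have h1 : max (x + 1) 0 = 0 := by omega
            have h2 : max x 0 = 0 := by omega
            simp [h1, h2]
      _ ≤ ∑ x ∈ Icc (0 : ℤ) (Np - 1), (1 + (Np : ℝ)) ^ ap := by
          rw [← sum_filter]
          refine sum_le_sum_of_subset_of_nonneg (fun x hx => (mem_filter.1 hx).2)
            fun _ _ _ => by positivity
      _ = Np * (1 + (Np : ℝ)) ^ ap := by simp

theorem metroGap_le_left {am ap : ℝ} (ham : 0 ≤ am) (Nm Np : ℕ) (hN : 1 ≤ Nm) :
    metroGap am ap Nm Np ≤ 96 * 2 ^ am / (Nm : ℝ) ^ 2 := by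
  have hN' : (0 : ℝ) < Nm := by exact_mod_cast hN
  rw [← energy_div_variance_eq hN']
  refine metroGap_le (fun x => ((max (-x) 0 : ℤ) : ℝ)) (by positivity) (fun c => ?_) ?_
  · refine le_sum_sub_sq_mul ham (f := fun k => -(k : ℤ))
      (fun i j hij => by simpa using hij) (fun k hk => ?_)
      (fun x => (metroF_pos am ap x).le) (metroF_neg_natCast am ap) (fun k => ?_) c
    · simp only [mem_Icc]; omega
    · simp
  · calc _ ≤ ∑ x ∈ Icc (-(Nm : ℤ)) (Np - 1),
            if x ∈ Icc (-(Nm : ℤ)) (-1) then (1 + (Nm : ℝ)) ^ am else 0 := by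
          refine sum_le_sum fun x hx => ?_
          simp only [mem_Icc] at hx ⊢
          split_ifs with h
          · obtain ⟨k, hk0⟩ := Int.eq_ofNat_of_zero_le (a := -x) (by omega)
            obtain rfl : x = -(k : ℤ) := by omega
            have hk : (k : ℝ) ≤ Nm := by exact_mod_cast (by omega : k ≤ Nm)
            have h1 : max (-(-(k : ℤ) + 1)) 0 = k - 1 := by omega
            have h2 : max (-(-(k : ℤ))) 0 = k := by omega
            have h3 : metroF am ap (-k) ≤ (1 + (Nm : ℝ)) ^ am := by
              rw [metroF_neg_natCast]
              gcongr
            have h4 : 0 < metroF am ap (-k) := metroF_pos am ap _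
            rw [h1, h2]
            push_cast
            have := min_le_left (metroF am ap (-k)) (metroF am ap (-k + 1))
            linarith
          · have h1 : max (-(x + 1)) 0 = 0 := by omega
            have h2 : max (-x) 0 = 0 := by omega
            rw [h1, h2]
            simp
      _ ≤ ∑ x ∈ Icc (-(Nm : ℤ)) (-1), (1 + (Nm : ℝ)) ^ am := by
          rw [← sum_filter]
          refine sum_le_sum_of_subset_of_nonneg (fun x hx => (mem_filter.1 hx).2)
            fun _ _ _ => by positivity
      _ = Nm * (1 + (Nm : ℝ)) ^ am := by simp

/-- The bottleneck at the origin: testing with the indicator of `{x ≤ 0}`. -/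
theorem metroGap_le_bottleneck {am ap : ℝ} (ham : 0 ≤ am) (hap : 0 ≤ ap) (Nm Np : ℕ)
    (hN : 1 ≤ Np) :
    metroGap am ap Nm Np ≤
      1 / (min (((1 + (Nm : ℝ)) / 2) ^ (1 + am)) (((1 + (Np : ℝ)) / 2) ^ (1 + ap)) / 2) := by
  refine metroGap_le (fun x => if x ≤ 0 then 1 else 0) (by positivity) (fun c => ?_) ?_
  · have hm : ((1 + (Nm : ℝ)) / 2) ^ (1 + am) ≤
        ∑ x ∈ (Icc (-(Nm : ℤ)) Np).filter (· ≤ 0), metroF am ap x :=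
      le_sum_of_rpow ham (f := fun k => -(k : ℤ)) (fun i j hij => by simpa using hij)
        (fun k hk _ => by simp only [mem_filter, mem_Icc]; omega)
        (fun x => (metroF_pos am ap x).le) (metroF_neg_natCast am ap)
    have hp : ((1 + (Np : ℝ)) / 2) ^ (1 + ap) ≤
        ∑ x ∈ (Icc (-(Nm : ℤ)) Np).filter (¬ · ≤ 0), metroF am ap x :=
      le_sum_of_rpow hap (f := fun k => (k : ℤ)) Nat.cast_injective
        (fun k hk _ => by simp only [mem_filter, mem_Icc]; omega)
        (fun x => (metroF_pos am ap x).le) (metroF_natCast am ap)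
    rw [← sum_filter_add_sum_filter_not _ (· ≤ (0 : ℤ))]
    set m := min (((1 + (Nm : ℝ)) / 2) ^ (1 + am)) (((1 + (Np : ℝ)) / 2) ^ (1 + ap))
    have hm0 : 0 < m := by positivity
    calc m / 2 ≤ (1 - c) ^ 2 * m + (0 - c) ^ 2 * m := by
          nlinarith [mul_nonneg hm0.le (sq_nonneg (1 - 2 * c))]
      _ ≤ (1 - c) ^ 2 * ∑ x ∈ (Icc (-(Nm : ℤ)) Np).filter (· ≤ 0), metroF am ap x +
          (0 - c) ^ 2 * ∑ x ∈ (Icc (-(Nm : ℤ)) Np).filter (¬ · ≤ 0), metroF am ap x := by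
          gcongr
          · exact (min_le_left _ _).trans hm
          · exact (min_le_right _ _).trans hp
      _ = _ := by
          rw [mul_sum, mul_sum]
          congr 1 <;> refine sum_congr rfl fun x hx => ?_
          · simp [(mem_filter.1 hx).2]
          · simp [(mem_filter.1 hx).2]
  · rw [sum_eq_single_of_mem (0 : ℤ) (by simp only [mem_Icc]; omega)]
    · have h0 : metroF am ap 0 = 1 := by simp [metroF]
      have h1 : min (metroF am ap 0) (metroF am ap (0 + 1)) ≤ 1 := h0 ▸ min_le_left _ _
      norm_num at h1 ⊢
      grind
    · intro x _ hx
      rcases lt_or_gt_of_ne hx with h | h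
      · simp [show x ≤ 0 by omega, show x + 1 ≤ 0 by omega]
      · simp [show ¬ x ≤ 0 by omega, show ¬ x + 1 ≤ 0 by omega]

theorem metroGap_le_inv_sq {am ap : ℝ} (ham : 0 ≤ am) (hap : 0 ≤ ap) (Nm Np : ℕ)
    (hN : 1 ≤ Nm + Np) :
    metroGap am ap Nm Np ≤ 384 * 2 ^ (am + ap) * (1 / ((Nm : ℝ) + Np) ^ 2) := by
  have key : ∀ (a M N : ℝ), 0 ≤ N → N ≤ M → 0 < M → a ≤ am + ap →
      96 * 2 ^ a / M ^ 2 ≤ 384 * 2 ^ (am + ap) * (1 / (M + N) ^ 2) := by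
    intro a M N hN hNM hM ha
    calc 96 * (2 : ℝ) ^ a / M ^ 2 ≤ 96 * (2 : ℝ) ^ (am + ap) / M ^ 2 := by
          gcongr
          norm_num
      _ = 384 * 2 ^ (am + ap) * (1 / (M + M) ^ 2) := by
          field_simp
          norm_num
      _ ≤ _ := by gcongr
  rcases le_total Nm Np with h | h
  · rw [add_comm (Nm : ℝ)]
    exact (metroGap_le_right hap Nm Np (by omega)).trans
      (key ap Np Nm (by positivity) (by exact_mod_cast h)
        (by exact_mod_cast (by omega : 0 < Np)) (by linarith))
  · exact (metroGap_le_left ham Nm Np (by omega)).trans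
      (key am Nm Np (by positivity) (by exact_mod_cast h)
        (by exact_mod_cast (by omega : 0 < Nm)) (by linarith))

theorem inv_half_rpow_le {a b N : ℝ} (hb : a ≤ b) (hN : 0 ≤ N) :
    (((1 + N) / 2) ^ (1 + a))⁻¹ ≤ 2 ^ (1 + b) * (1 + N) ^ (-(1 + a)) := by
  rw [Real.div_rpow (by positivity) (by positivity), inv_div, Real.rpow_neg (by positivity),
    div_eq_mul_inv]
  gcongr
  norm_num

/-- Lemma `lem-1`: upper bound on the spectral gap of the
asymmetric chain on `{-N⁻,…,N⁺}`. -/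
theorem gap_asymmetric_upper (am ap : ℝ) (ham : 0 ≤ am) (hap : 0 ≤ ap) :
    ∃ C : ℝ, 0 < C ∧ ∀ Nm Np : ℤ, 0 ≤ Nm → 0 ≤ Np → 1 ≤ Nm + Np →
      metroGap am ap Nm Np ≤
        C * min (1 / ((Nm : ℝ) + (Np : ℝ)) ^ 2)
          (max (((1 + Nm : ℤ) : ℝ) ^ (-(1 + am))) (((1 + Np : ℤ) : ℝ) ^ (-(1 + ap)))) := by
  refine ⟨384 * 2 ^ (am + ap), by positivity, fun Nm Np hm hp hN => ?_⟩
  lift Nm to ℕ using hm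
  lift Np to ℕ using hp
  have h1 := metroGap_le_inv_sq ham hap Nm Np (by omega)
  rw [mul_min_of_nonneg _ _ (by positivity)]
  push_cast
  refine le_min h1 ?_
  rcases Nat.eq_zero_or_pos Np with rfl | hNp
  · refine h1.trans ?_
    gcongr
    refine le_max_of_le_right ?_
    have : (1 : ℝ) ≤ Nm := by exact_mod_cast (by omega : 1 ≤ Nm)
    simp only [CharP.cast_eq_zero, add_zero, Real.one_rpow]
    rw [div_le_one (by positivity)]
    nlinarith
  · refine (metroGap_le_bottleneck ham hap Nm Np hNp).trans ?_
    set M := max ((1 + (Nm : ℝ)) ^ (-(1 + am))) ((1 + (Np : ℝ)) ^ (-(1 + ap))) with hM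
    have hM0 : 0 < M := by positivity
    have h2 : 2 * 2 ^ (1 + (am + ap)) * M ≤ 384 * 2 ^ (am + ap) * M := by
      gcongr ?_ * M
      rw [Real.rpow_add (by norm_num), Real.rpow_one]
      have : 0 < (2 : ℝ) ^ (am + ap) := by positivity
      linarith
    refine le_trans ?_ h2
    rw [one_div_div, div_eq_mul_inv, mul_assoc]
    gcongr
    rcases min_choice (((1 + (Nm : ℝ)) / 2) ^ (1 + am)) (((1 + (Np : ℝ)) / 2) ^ (1 + ap))
      with h | h <;> rw [h]
    · refine (inv_half_rpow_le (b := am + ap) (by linarith) (by positivity)).trans ?_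
      gcongr
      exact le_max_left _ _
    · refine (inv_half_rpow_le (b := am + ap) (by linarith) (by positivity)).trans ?_
      gcongr
      exact le_max_right _ _
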